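/- arXiv:1402.7153 — 6 statements merged into one kernel-verified Lean document; each statement's English description precedes it below -/
import Mathlib

section
/- Let (A, m) be a demi local ring which is finite over a central subring R. Then m ∩ R is the unique maximal ideal of R; in particular, (R, m ∩ R) is a local ring in the usual sense of commutative algebra. -/
namespace TwoSidedIdeal

/-- The union of a nonempty directed family of two-sided ideals, as a two-sided ideal. -/
def directedUnion {A : Type*} [Ring A] (s : Set (TwoSidedIdeal A)) (hs : s.Nonempty)
    (hd : DirectedOn (· ≤ ·) s) : TwoSidedIdeal A :=
  mk' {x | ∃ I ∈ s, x ∈ I}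
    (hs.imp fun I hI ↦ ⟨hI, I.zero_mem⟩)
    (by
      rintro x y ⟨I, hI, hx⟩ ⟨J, hJ, hy⟩
      obtain ⟨K, hK, hIK, hJK⟩ := hd I hI J hJ
      exact ⟨K, hK, K.add_mem (hIK hx) (hJK hy)⟩)
    (fun ⟨I, hI, hx⟩ ↦ ⟨I, hI, I.neg_mem hx⟩)
    (fun ⟨I, hI, hx⟩ ↦ ⟨I, hI, I.mul_mem_left _ _ hx⟩)
    (fun ⟨I, hI, hx⟩ ↦ ⟨I, hI, I.mul_mem_right _ _ hx⟩)

theorem mem_directedUnion {A : Type*} [Ring A] {s : Set (TwoSidedIdeal A)} (hs : s.Nonempty)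
    (hd : DirectedOn (· ≤ ·) s) {x : A} : x ∈ directedUnion s hs hd ↔ ∃ I ∈ s, x ∈ I :=
  mem_mk' ..

theorem isCoatomic (A : Type*) [Ring A] : IsCoatomic (TwoSidedIdeal A) := by
  refine CompleteLattice.coatomic_of_top_compact fun s u hs hd hu htop ↦ ?_
  have hle : u ≤ directedUnion s hs hd :=
    hu.2 fun I hI x hx ↦ (mem_directedUnion hs hd).2 ⟨I, hI, hx⟩
  obtain ⟨I, hI, h1⟩ := (mem_directedUnion hs hd).1 (hle (htop (mem_top A (x := 1))))
  exact ⟨I, hI, (I.one_mem_iff.1 h1).ge⟩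

/-- The two-sided ideal of an algebra generated by an ideal of the base ring. -/
def extendScalars {R : Type*} (A : Type*) [CommRing R] [Ring A] [Algebra R A] (J : Ideal R) :
    TwoSidedIdeal A :=
  mk' (J • (⊤ : Submodule R A) : Submodule R A) (Submodule.zero_mem _) (Submodule.add_mem _)
    (Submodule.neg_mem _)
    (by
      intro x y hy
      refine Submodule.smul_induction_on hy (fun r hr a _ ↦ ?_) fun a b ha hb ↦ ?_
      · rw [mul_smul_comm]
        exact Submodule.smul_mem_smul hr Submodule.mem_top
      · rw [mul_add]
        exact Submodule.add_mem _ ha hb)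
    (by
      intro x y hx
      refine Submodule.smul_induction_on hx (fun r hr a _ ↦ ?_) fun a b ha hb ↦ ?_
      · rw [smul_mul_assoc]
        exact Submodule.smul_mem_smul hr Submodule.mem_top
      · rw [add_mul]
        exact Submodule.add_mem _ ha hb)

variable {R A : Type*} [CommRing R] [Ring A] [Algebra R A]

theorem mem_extendScalars {J : Ideal R} {x : A} :
    x ∈ extendScalars A J ↔ x ∈ J • (⊤ : Submodule R A) :=
  mem_mk' ..

theorem algebraMap_mem_extendScalars {J : Ideal R} {r : R} (hr : r ∈ J) :
    algebraMap R A r ∈ extendScalars A J := by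
  rw [mem_extendScalars, Algebra.algebraMap_eq_smul_one]
  exact Submodule.smul_mem_smul hr Submodule.mem_top

theorem extendScalars_ne_top [Module.Finite R A] (hinj : Function.Injective (algebraMap R A))
    {J : Ideal R} (hJ : J ≠ ⊤) : extendScalars A J ≠ ⊤ := by
  intro h
  have hle : (⊤ : Submodule R A) ≤ J • ⊤ := fun x _ ↦
    mem_extendScalars.1 (h ▸ mem_top A)
  obtain ⟨r, hr, hr0⟩ := Submodule.exists_sub_one_mem_and_smul_eq_zero_of_fg_of_le_smul J ⊤
    Module.Finite.fg_top hle
  have h0 : r = 0 := hinj <| by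
    rw [map_zero, Algebra.algebraMap_eq_smul_one, hr0 1 Submodule.mem_top]
  rw [h0, zero_sub, neg_mem_iff] at hr
  exact hJ ((Ideal.eq_top_iff_one J).2 hr)

theorem isMaximal_comap_asIdeal_and_unique [Module.Finite R A]
    (hinj : Function.Injective (algebraMap R A)) {m : TwoSidedIdeal A} (hmax : IsCoatom m)
    (huniq : ∀ m' : TwoSidedIdeal A, IsCoatom m' → m' = m) :
    (m.asIdeal.comap (algebraMap R A)).IsMaximal ∧
      ∀ J : Ideal R, J.IsMaximal → J = m.asIdeal.comap (algebraMap R A) := by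
  have hone : (1 : A) ∉ m := fun h ↦ hmax.1 (m.one_mem_iff.1 h)
  have hne : m.asIdeal.comap (algebraMap R A) ≠ ⊤ := by
    rw [Ideal.ne_top_iff_one, Ideal.mem_comap, map_one, mem_asIdeal]
    exact hone
  have key : ∀ J : Ideal R, J.IsMaximal → J = m.asIdeal.comap (algebraMap R A) := by
    intro J hJ
    have := isCoatomic A
    obtain ⟨m', hm', hle⟩ :=
      (eq_top_or_exists_le_coatom (extendScalars A J)).resolve_left
        (extendScalars_ne_top hinj hJ.ne_top)
    obtain rfl := huniq m' hm'
    exact hJ.eq_of_le hne fun r hr ↦ Ideal.mem_comap.2 <| mem_asIdeal.2 <|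
      hle (algebraMap_mem_extendScalars hr)
  obtain ⟨J, hJ, -⟩ := Ideal.exists_le_maximal _ hne
  exact ⟨key J hJ ▸ hJ, key⟩

end TwoSidedIdeal

/-- Let `(A, m)` be a demi local ring (a ring with exactly one maximal
two-sided ideal `m`) which is finite over a central subring `R`.  Then `m ∩ R` is the
unique maximal ideal of `R`; in particular `(R, m ∩ R)` is a local ring in the usual
commutative sense. -/
theorem demiLocal_center_isLocal {A : Type*} [Ring A] (m : TwoSidedIdeal A)
    (hmax : IsCoatom m) (huniq : ∀ m' : TwoSidedIdeal A, IsCoatom m' → m' = m)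
    (R : Subring A) (hcent : ∀ r ∈ R, ∀ a : A, r * a = a * r)
    [Module.Finite R A] :
    (Ideal.comap R.subtype m.asIdeal).IsMaximal ∧
      ∀ J : Ideal R, J.IsMaximal → J = Ideal.comap R.subtype m.asIdeal := by
  let _ : CommRing R :=
    { (inferInstance : Ring R) with mul_comm := fun a b ↦ Subtype.ext (hcent a a.2 b) }
  let _ : Algebra R A :=
    { algebraMap := R.subtype
      commutes' := fun r a ↦ hcent r r.2 a
      smul_def' := fun _ _ ↦ rfl }
  exact TwoSidedIdeal.isMaximal_comap_asIdeal_and_unique (R := R) (A := A)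
    Subtype.val_injective hmax huniq
end

section
/- Let A be a ring which is finite over a central subring R. Then for any maximal two-sided ideal M of A, the intersection M ∩ R is a maximal ideal of R. -/
/-- For a central element `x`, the two-sided ideal `M + xA`. -/
def TwoSidedIdeal.addCentralMul {A : Type*} [Ring A] (M : TwoSidedIdeal A) (x : A)
    (hx : ∀ a : A, x * a = a * x) : TwoSidedIdeal A :=
  .mk' {a | ∃ b, a - x * b ∈ M}
    ⟨0, by simp [M.zero_mem]⟩
    (by
      rintro a b ⟨c, hc⟩ ⟨d, hd⟩
      refine ⟨c + d, ?_⟩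
      convert M.add_mem hc hd using 1
      noncomm_ring)
    (by
      rintro a ⟨c, hc⟩
      refine ⟨-c, ?_⟩
      convert M.neg_mem hc using 1
      noncomm_ring)
    (by
      rintro a b ⟨c, hc⟩
      refine ⟨a * c, ?_⟩
      convert M.mul_mem_left a _ hc using 1
      rw [mul_sub, ← mul_assoc, hx, ← mul_assoc])
    (by
      rintro a b ⟨c, hc⟩
      refine ⟨c * b, ?_⟩
      convert M.mul_mem_right _ b hc using 1
      noncomm_ring)

theorem TwoSidedIdeal.mem_addCentralMul {A : Type*} [Ring A] {M : TwoSidedIdeal A} {x : A}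
    {hx : ∀ a : A, x * a = a * x} {a : A} :
    a ∈ M.addCentralMul x hx ↔ ∃ b, a - x * b ∈ M :=
  TwoSidedIdeal.mem_mk' ..

/-- A maximal two-sided ideal `M` and a central element `x ∉ M` satisfy `M + xA = A`. -/
theorem TwoSidedIdeal.exists_sub_mul_mem_of_isCoatom {A : Type*} [Ring A] {M : TwoSidedIdeal A}
    (hM : IsCoatom M) {x : A} (hx : ∀ a : A, x * a = a * x) (hxM : x ∉ M) (a : A) :
    ∃ b, a - x * b ∈ M := by
  have hlt : M < M.addCentralMul x hx := by
    refine lt_of_le_of_ne (fun m hm ↦ mem_addCentralMul.2 ⟨0, by simpa using hm⟩) fun h ↦ hxM ?_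
    rw [h]
    exact mem_addCentralMul.2 ⟨1, by simp [M.zero_mem]⟩
  rw [← mem_addCentralMul (hx := hx), hM.2 _ hlt]
  trivial

/-- Let `A` be a ring which is finite over a central subring `R`.
Then for any maximal two-sided ideal `M` of `A`, the intersection `M ∩ R` is a
maximal ideal of `R`. -/
theorem maximalTwoSided_restrict_isMaximal {A : Type*} [Ring A]
    (R : Subring A) (hcent : ∀ r ∈ R, ∀ a : A, r * a = a * r)
    [Module.Finite R A]
    (M : TwoSidedIdeal A) (hM : IsCoatom M) :
    (Ideal.comap R.subtype M.asIdeal).IsMaximal := by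
  let _ : CommRing R :=
    { (inferInstance : Ring R) with mul_comm := fun a b ↦ Subtype.ext (hcent a a.2 b) }
  refine Ideal.isMaximal_iff.2 ⟨fun h ↦ hM.1 (M.one_mem_iff.1 ?_), fun J x hJ hx hxJ ↦ ?_⟩
  · simpa [TwoSidedIdeal.mem_asIdeal] using h
  have hxM : (x : A) ∉ M := fun h ↦ hx (TwoSidedIdeal.mem_asIdeal.2 h)
  let N : Submodule R A :=
    { carrier := {a | a ∈ M}
      add_mem' := M.add_mem
      zero_mem' := M.zero_mem
      smul_mem' := fun r _ ha ↦ M.mul_mem_left r _ ha }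
  have hN : (⊤ : Submodule R A) ≤ N ⊔ J • (⊤ : Submodule R A) := fun a _ ↦ by
    obtain ⟨b, hb⟩ := TwoSidedIdeal.exists_sub_mul_mem_of_isCoatom hM (hcent x x.2) hxM a
    exact Submodule.mem_sup.2
      ⟨_, hb, _, Submodule.smul_mem_smul hxJ (Submodule.mem_top (x := b)), sub_add_cancel ..⟩
  obtain ⟨r, hrJ, hr⟩ :=
    Submodule.exists_sub_one_mem_and_smul_le_of_fg_of_le_sup Module.Finite.fg_top le_rfl hN
  have hrM : (r : A) ∈ M := by
    have h : r • (1 : A) ∈ N := hr (Submodule.smul_mem_pointwise_smul _ _ _ Submodule.mem_top)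
    simpa [Subring.smul_def] using show (r • (1 : A)) ∈ M from h
  have hr' : r ∈ J := hJ (TwoSidedIdeal.mem_asIdeal.2 hrM)
  simpa using J.sub_mem hr' hrJ
end

section
/- Let A be a ring which is finite over a central subring R. Then for any maximal ideal m of R, the set S = { M : M is a maximal two-sided ideal of A and M ∩ R = m } of maximal two-sided ideals of A lying over m is a finite set. -/
namespace TwoSidedIdeal

variable {A : Type*} [Ring A]

theorem codisjoint_inf {I J M : TwoSidedIdeal A} (hI : Codisjoint I M) (hJ : Codisjoint J M) :
    Codisjoint (I ⊓ J) M := by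
  rw [codisjoint_iff] at *
  rw [← one_mem_iff, mem_sup] at *
  obtain ⟨a, ha, b, hb, hab⟩ := hI
  obtain ⟨c, hc, d, hd, hcd⟩ := hJ
  refine ⟨a * c, (mem_inf _).2 ⟨mul_mem_right _ _ _ ha, mul_mem_left _ _ _ hc⟩, a * d + b,
    add_mem _ (mul_mem_left _ _ _ hd) hb, ?_⟩
  rw [← add_assoc, ← mul_add, hcd, mul_one, hab]

theorem codisjoint_finset_inf {M : TwoSidedIdeal A} {t : Finset (TwoSidedIdeal A)}
    (h : ∀ I ∈ t, Codisjoint I M) : Codisjoint (t.inf id) M :=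
  Finset.inf_induction (p := fun I ↦ Codisjoint I M) codisjoint_top_left
    (fun _ hI _ hJ ↦ codisjoint_inf hI hJ) h

theorem mem_of_finset_inf_le {M : TwoSidedIdeal A} (hM : IsCoatom M)
    {t : Finset (TwoSidedIdeal A)} (ht : ∀ I ∈ t, IsCoatom I) (hle : t.inf id ≤ M) : M ∈ t := by
  by_contra hMt
  refine hM.1 ((codisjoint_finset_inf fun I hI ↦ ?_).eq_top_of_ge hle)
  exact (ht I hI).codisjoint_of_ne hM fun h ↦ hMt (h ▸ hI)

end TwoSidedIdeal

theorem isArtinian_quotient_smul_top {R N : Type*} [CommRing R] [AddCommGroup N] [Module R N]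
    [Module.Finite R N] (m : Ideal R) [m.IsMaximal] :
    IsArtinian R (N ⧸ (m • ⊤ : Submodule R N)) := by
  let : Field (R ⧸ m) := Ideal.Quotient.field m
  have : Module.Finite (R ⧸ m) (N ⧸ (m • ⊤ : Submodule R N)) :=
    Module.Finite.of_restrictScalars_finite R _ _
  have : RingHomSurjective (Ideal.Quotient.mk m) := ⟨Ideal.Quotient.mk_surjective⟩
  let f : (N ⧸ (m • ⊤ : Submodule R N)) →ₛₗ[Ideal.Quotient.mk m]
      (N ⧸ (m • ⊤ : Submodule R N)) :=
    { toFun := id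
      map_add' := fun _ _ ↦ rfl
      map_smul' := fun r x ↦ (algebraMap_smul (R ⧸ m) r x).symm }
  exact (LinearMap.isArtinian_iff_of_bijective f Function.bijective_id).2 inferInstance

theorem TwoSidedIdeal.finite_setOf_isCoatom_smul_top_le {R A : Type*} [CommRing R] [Ring A]
    [Module R A] [IsScalarTower R A A] [Module.Finite R A] (m : Ideal R) [m.IsMaximal] :
    {M : TwoSidedIdeal A | IsCoatom M ∧
      (m • ⊤ : Submodule R A) ≤ M.asIdeal.restrictScalars R}.Finite := by
  set S := {M : TwoSidedIdeal A | IsCoatom M ∧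
      (m • ⊤ : Submodule R A) ≤ M.asIdeal.restrictScalars R}
  have := isArtinian_quotient_smul_top (N := A) m
  let f (t : Finset (TwoSidedIdeal A)) : Submodule R (A ⧸ (m • ⊤ : Submodule R A)) :=
    ((t.inf id).asIdeal.restrictScalars R).map (Submodule.mkQ _)
  obtain ⟨t, htS, hmin⟩ := (InvImage.wf f wellFounded_lt).has_min
    {t : Finset (TwoSidedIdeal A) | ↑t ⊆ S} ⟨∅, by simp⟩
  refine t.finite_toSet.subset fun M hM ↦ ?_
  refine mem_of_finset_inf_le hM.1 (fun I hI ↦ (htS hI).1) fun x hx ↦ ?_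
  classical
  have hle : f (insert M t) ≤ f t := Submodule.map_mono fun y hy ↦ by
    have hy : y ∈ (insert M t).inf id := hy
    rw [Finset.inf_insert, mem_inf] at hy
    exact hy.2
  have heq : f t ≤ f (insert M t) := by
    by_contra h
    exact hmin (insert M t) (by simpa [Set.insert_subset_iff] using ⟨hM, htS⟩)
      (lt_of_le_not_ge hle h)
  obtain ⟨y, hy, hxy⟩ := heq (Submodule.mem_map_of_mem (f := Submodule.mkQ _) hx)
  have hy : y ∈ (insert M t).inf id := hy
  rw [Finset.inf_insert, mem_inf] at hy
  have hyx : y - x ∈ M := hM.2 ((Submodule.Quotient.eq _).1 hxy)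
  simpa using sub_mem _ hy.1 hyx


/-- Let `A` be a ring which is finite over a central subring `R`.
Then for any maximal ideal `m` of `R`, the set of maximal two-sided ideals `M` of `A`
lying over `m` (i.e. with `M ∩ R = m`) is finite. -/
theorem maximalTwoSided_lyingOver_finite {A : Type*} [Ring A]
    (R : Subring A) (hcent : ∀ r ∈ R, ∀ a : A, r * a = a * r)
    [Module.Finite R A]
    (m : Ideal R) (hm : m.IsMaximal) :
    {M : TwoSidedIdeal A | IsCoatom M ∧ Ideal.comap R.subtype M.asIdeal = m}.Finite := by
  let : CommRing R := { R.toRing with mul_comm := fun r s ↦ Subtype.ext (hcent r r.2 s) }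
  have := hm
  refine (TwoSidedIdeal.finite_setOf_isCoatom_smul_top_le (A := A) m).subset ?_
  rintro M ⟨hM, rfl⟩
  refine ⟨hM, Submodule.smul_le.2 fun r hr a _ ↦ ?_⟩
  exact M.mul_mem_right _ a hr
end

section
/- Let A be a ring which is finite over a central subring R, let m be a maximal ideal of R, and let S be the (finite) set of maximal two-sided ideals of A lying over m. Then the intersection N = ⋂_{M ∈ S} M satisfies N^{k₀} ⊆ m·A for some positive integer k₀, where m·A denotes the two-sided ideal of A generated by m. -/
/-- The coatoms of the lattice of two-sided ideals of a semisimple ring intersect in zero. -/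
theorem TwoSidedIdeal.sInf_isCoatom_eq_bot (C : Type*) [Ring C] [IsSemisimpleRing C] :
    sInf {M : TwoSidedIdeal C | IsCoatom M} = ⊥ := by
  let e₁ : fullyInvariantSubmodule C C ≃o {I : Ideal C // I.IsTwoSided} :=
    { Equiv.subtypeEquivRight fun _ ↦ isFullyInvariant_iff_isTwoSided with
      map_rel_iff' := Iff.rfl }
  let e : Set (isotypicComponents C C) ≃o TwoSidedIdeal C :=
    (OrderIso.setIsotypicComponents.trans e₁).trans TwoSidedIdeal.orderIsoIsTwoSided.symm
  rw [← e.symm.injective.eq_iff, e.symm.map_bot, Set.bot_eq_empty, Set.eq_empty_iff_forall_notMem]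
  intro a ha
  have hc : IsCoatom (e {a}ᶜ) := (e.isCoatom_iff _).mpr (Set.isCoatom_singleton_compl a)
  have hle : e.symm (sInf {M : TwoSidedIdeal C | IsCoatom M}) ≤ {a}ᶜ :=
    e.symm_apply_le.mpr (sInf_le hc)
  exact hle ha rfl

/-- The preimage of a maximal two-sided ideal under a surjective ring homomorphism is maximal. -/
theorem TwoSidedIdeal.isCoatom_comap_of_surjective {A C : Type*} [Ring A] [Ring C] (f : A →+* C)
    (hf : Function.Surjective f) {M : TwoSidedIdeal C} (hM : IsCoatom M) :
    IsCoatom (M.comap f) := by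
  refine ⟨fun h ↦ hM.1 ?_, fun K hK ↦ ?_⟩
  · rw [← TwoSidedIdeal.one_mem_iff] at h ⊢
    simpa [TwoSidedIdeal.mem_comap] using h
  · obtain ⟨y, hyK, hyM⟩ := SetLike.exists_of_lt hK
    let L : TwoSidedIdeal C := .mk' (f '' K)
      ⟨0, K.zero_mem, map_zero f⟩
      (by
        rintro _ _ ⟨a, ha, rfl⟩ ⟨b, hb, rfl⟩
        exact ⟨a + b, K.add_mem ha hb, map_add f a b⟩)
      (by
        rintro _ ⟨a, ha, rfl⟩
        exact ⟨-a, K.neg_mem ha, map_neg f a⟩)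
      (by
        rintro c _ ⟨a, ha, rfl⟩
        obtain ⟨b, rfl⟩ := hf c
        exact ⟨b * a, K.mul_mem_left _ _ ha, map_mul f b a⟩)
      (by
        rintro _ c ⟨a, ha, rfl⟩
        obtain ⟨b, rfl⟩ := hf c
        exact ⟨a * b, K.mul_mem_right _ _ ha, map_mul f a b⟩)
    have hL (c : C) : c ∈ L ↔ ∃ a ∈ K, f a = c := TwoSidedIdeal.mem_mk' ..
    have hML : M < L := by
      refine SetLike.lt_iff_le_and_exists.mpr ⟨fun c hc ↦ ?_, f y, (hL _).mpr ⟨y, hyK, rfl⟩, ?_⟩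
      · obtain ⟨b, rfl⟩ := hf c
        exact (hL _).mpr ⟨b, hK.le ((TwoSidedIdeal.mem_comap f).mpr hc), rfl⟩
      · rwa [TwoSidedIdeal.mem_comap] at hyM
    obtain ⟨a, ha, ha1⟩ := (hL 1).mp (hM.2 L hML ▸ TwoSidedIdeal.mem_top C)
    rw [← TwoSidedIdeal.one_mem_iff]
    have h1 : 1 - a ∈ M.comap f := by
      rw [TwoSidedIdeal.mem_comap, map_sub, map_one, ha1, sub_self]
      exact M.zero_mem
    simpa using K.add_mem (hK.le h1) ha

/-- A finitely generated module annihilated by a maximal left ideal is Artinian. -/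
theorem IsArtinian.of_finite_of_isMaximal_smul_eq_zero {R V : Type*} [Ring R] [AddCommGroup V]
    [Module R V] [Module.Finite R V] (m : Ideal R) (hm : m.IsMaximal)
    (h : ∀ r ∈ m, ∀ v : V, r • v = 0) : IsArtinian R V := by
  have : IsSimpleModule R (R ⧸ m) := isSimpleModule_iff_isCoatom.mpr hm.out
  obtain ⟨n, s, hs⟩ := Module.Finite.exists_fin (R := R) (M := V)
  let g (i : Fin n) : (R ⧸ m) →ₗ[R] V :=
    m.liftQ (LinearMap.toSpanSingleton R V (s i)) fun r hr ↦ LinearMap.mem_ker.mpr (h r hr _)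
  have htop : ⨆ i, LinearMap.range (g i) = ⊤ := by
    rw [← hs, Submodule.span_range_eq_iSup]
    exact iSup_congr fun i ↦ (Submodule.range_liftQ ..).trans (LinearMap.range_toSpanSingleton _)
  have : IsArtinian R (⊤ : Submodule R V) := htop ▸ inferInstance
  exact isArtinian_of_linearEquiv Submodule.topEquiv

/-- A left ideal generated by central elements is two-sided. -/
theorem Ideal.isTwoSided_span_of_subset_center {A : Type*} [Ring A] {s : Set A}
    (hs : s ⊆ Set.center A) : (Ideal.span s).IsTwoSided where
  mul_mem_of_left {a} b ha := by
    induction ha using Submodule.span_induction with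
    | mem x hx =>
      rw [(Set.mem_center_iff.mp (hs hx)).comm b]
      exact Ideal.mul_mem_left _ b (Ideal.subset_span hx)
    | zero => simp
    | add x y _ _ hx hy => rw [add_mul]; exact add_mem hx hy
    | smul c x _ hx => rw [smul_eq_mul, mul_assoc]; exact Ideal.mul_mem_left _ c hx

theorem Ideal.prod_ofFn_mem_pow {B : Type*} [Ring B] (I : Ideal B) {n : ℕ} (x : Fin n → B)
    (hx : ∀ i, x i ∈ I) : (List.ofFn x).prod ∈ I ^ n := by
  induction n with
  | zero => exact Submodule.one_le.mp le_rfl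
  | succ n ih =>
    rw [List.ofFn_succ', List.concat_eq_append, List.prod_append, List.prod_singleton,
      Submodule.pow_succ]
    exact Submodule.mul_mem_mul (ih _ fun i ↦ hx i.castSucc) (hx (Fin.last n))


/-- Let `A` be a ring which is finite over a central subring `R`, let
`m` be a maximal ideal of `R`, and let `S` be the set of maximal two-sided ideals of
`A` lying over `m`.  Then the intersection `N = ⋂_{M ∈ S} M` satisfies `N^{k₀} ⊆ m·A`
for some positive integer `k₀` (containment being expressed by: every product of `k₀`
elements of `N` lies in the ideal of `A` generated by `m`). -/
theorem maximalTwoSided_lyingOver_inter_pow_le {A : Type*} [Ring A]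
    (R : Subring A) (hcent : ∀ r ∈ R, ∀ a : A, r * a = a * r)
    [Module.Finite R A]
    (m : Ideal R) (hm : m.IsMaximal) :
    ∃ k₀ : ℕ, 0 < k₀ ∧ ∀ x : Fin k₀ → A,
      (∀ i, x i ∈ sInf {M : TwoSidedIdeal A |
          IsCoatom M ∧ Ideal.comap R.subtype M.asIdeal = m}) →
      (List.ofFn x).prod ∈ Ideal.map R.subtype m := by
  have hJ : (Ideal.map R.subtype m).IsTwoSided := by
    refine Ideal.isTwoSided_span_of_subset_center ?_
    rintro _ ⟨r, -, rfl⟩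
    exact Semigroup.mem_center_iff.mpr fun a ↦ (hcent r r.2 a).symm
  let B := A ⧸ Ideal.map R.subtype m
  let C := B ⧸ Ring.jacobson B
  have hB : IsArtinian R B := by
    refine .of_finite_of_isMaximal_smul_eq_zero m hm fun r hr v ↦ ?_
    obtain ⟨a, rfl⟩ := Ideal.Quotient.mk_surjective v
    refine Ideal.Quotient.eq_zero_iff_mem.mpr ?_
    exact Ideal.mul_mem_right a _ (Ideal.mem_map_of_mem R.subtype hr)
  have : IsArtinianRing B := isArtinian_of_tower R hB
  obtain ⟨n, hn⟩ := IsSemiprimaryRing.isNilpotent (R := B)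
  refine ⟨n + 1, n.succ_pos, fun x hx ↦ ?_⟩
  let f : A →+* C := (Ideal.Quotient.mk (Ring.jacobson B)).comp (Ideal.Quotient.mk _)
  have hf : Function.Surjective f :=
    Ideal.Quotient.mk_surjective.comp Ideal.Quotient.mk_surjective
  have hfx (i : Fin (n + 1)) : f (x i) = 0 := by
    rw [← TwoSidedIdeal.mem_bot, ← TwoSidedIdeal.sInf_isCoatom_eq_bot, TwoSidedIdeal.mem_sInf]
    intro M hM
    have hco := TwoSidedIdeal.isCoatom_comap_of_surjective f hf hM
    refine (TwoSidedIdeal.mem_comap f).mp ((TwoSidedIdeal.mem_sInf A).mp (hx i) _ ⟨hco, ?_⟩)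
    refine (hm.eq_of_le ?_ fun r hr ↦ ?_).symm
    · rw [Ideal.ne_top_iff_one]
      intro h
      exact hco.1 ((TwoSidedIdeal.one_mem_iff _).mp h)
    · have hfr : f r = 0 := by
        have h0 := Ideal.Quotient.eq_zero_iff_mem.mpr (Ideal.mem_map_of_mem R.subtype hr)
        exact (congrArg (Ideal.Quotient.mk (Ring.jacobson B)) h0).trans (map_zero _)
      rw [Ideal.mem_comap, TwoSidedIdeal.mem_asIdeal, TwoSidedIdeal.mem_comap]
      exact hfr ▸ M.zero_mem
  rw [← Ideal.Quotient.eq_zero_iff_mem, map_list_prod, List.map_ofFn]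
  have hmem := Ideal.prod_ofFn_mem_pow (Ring.jacobson B)
    (Ideal.Quotient.mk (Ideal.map R.subtype m) ∘ x)
    fun i ↦ Ideal.Quotient.eq_zero_iff_mem.mp (hfx i)
  rwa [Submodule.pow_succ, hn, Submodule.zero_eq_bot, Submodule.bot_mul] at hmem
end

section
/- Let A be a commutative ring which is finite over a noetherian subring R, let m be a maximal ideal of R, and let M₁, …, M_s be the maximal ideals of A lying over m. Then for every positive integer k there exists a positive integer N such that M₁^N ∩ ⋯ ∩ M_s^N ⊆ (M₁ ∩ ⋯ ∩ M_s)^k. -/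
/-- For a finite set of maximal ideals, the intersection of the `k`-th powers is the `k`-th power
of the intersection. -/
theorem Ideal.biInf_pow_eq_sInf_pow_of_isMaximal {A : Type*} [CommRing A] {S : Set (Ideal A)}
    (hfin : S.Finite) (hmax : ∀ M ∈ S, M.IsMaximal) (k : ℕ) :
    (⨅ M ∈ S, M ^ k) = sInf S ^ k := by
  have hcop : ∀ M ∈ S, ∀ N ∈ S, M ≠ N → IsCoprime M N := fun M hM N hN hne ↦
    have := hmax M hM
    have := hmax N hN
    Ideal.isCoprime_of_isMaximal hne
  have hpow := Ideal.prod_eq_iInf_of_pairwise_isCoprime (s := hfin.toFinset) (J := fun M ↦ M ^ k)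
    fun M hM N hN hne ↦ (hcop M (by simpa using hM) N (by simpa using hN) hne).pow
  have hone := Ideal.prod_eq_iInf_of_pairwise_isCoprime (s := hfin.toFinset) (J := fun M ↦ M)
    fun M hM N hN hne ↦ hcop M (by simpa using hM) N (by simpa using hN) hne
  simp only [Set.Finite.mem_toFinset] at hpow hone
  rw [sInf_eq_iInf, ← hpow, ← hone, Finset.prod_pow]


/-- Let `A` be a commutative ring which is finite over a noetherian
subring `R`, let `m` be a maximal ideal of `R`, and let `M₁, …, M_s` be the maximal
ideals of `A` lying over `m`.  Then for every positive integer `k` there is a positive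
integer `N` with `M₁^N ∩ ⋯ ∩ M_s^N ⊆ (M₁ ∩ ⋯ ∩ M_s)^k`. -/
theorem comm_finite_formally_decomposable {A : Type*} [CommRing A]
    (R : Subring A) [IsNoetherianRing R] [Module.Finite R A]
    (m : Ideal R) (hm : m.IsMaximal) :
    ∀ k : ℕ, 0 < k → ∃ N : ℕ, 0 < N ∧
      (⨅ M ∈ {M : Ideal A | M.IsMaximal ∧ Ideal.comap R.subtype M = m}, M ^ N) ≤
        (sInf {M : Ideal A | M.IsMaximal ∧ Ideal.comap R.subtype M = m}) ^ k := by
  intro k hk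
  have hfin : {M : Ideal A | M.IsMaximal ∧ Ideal.comap R.subtype M = m}.Finite :=
    (Algebra.QuasiFinite.finite_primesOver (S := A) m).subset
      fun M hM ↦ ⟨hM.1.isPrime, ⟨hM.2.symm⟩⟩
  exact ⟨k, hk, (Ideal.biInf_pow_eq_sInf_pow_of_isMaximal hfin (fun M hM ↦ hM.1) k).le⟩
end

section
/- Let A be a ring which is finite over a noetherian central subring R, let S be a multiplicative subset of R (so S is central in A and the localizations A[S⁻¹] and M[S⁻¹] are defined for any left A-module M). Let M be a left A-module and let E(M) be an injective hull of M, i.e. an injective left A-module containing M as an essential submodule (every nonzero submodule of E(M) meets M nontrivially). Then the localization E(M)[S⁻¹] is an injective hull of M[S⁻¹] as a left A[S⁻¹]-module: E(M)[S⁻¹] is an injective A[S⁻¹]-module and the canonical image of M[S⁻¹] is an essential A[S⁻¹]-submodule of E(M)[S⁻¹]. -/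
open OreLocalization

/-- A central multiplicative subset of a ring is a (left) Ore set. -/
def centralOreSet {A : Type*} [Ring A] (S : Submonoid A)
    (h : ∀ s ∈ S, ∀ a : A, s * a = a * s) : OreSet S where
  ore_right_cancel r₁ r₂ s hr := ⟨s, by
    rw [h s s.2 r₁, h s s.2 r₂] at *; exact hr⟩
  oreNum r _ := r
  oreDenom _ s := s
  ore_eq r s := by rw [h s s.2 r]

section Smallness

universe v

theorem LinearMap.exists_factor_of_surjective {A X Y Z : Type*} [Ring A] [AddCommGroup X]
    [AddCommGroup Y] [AddCommGroup Z] [Module A X] [Module A Y] [Module A Z]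
    (p : X →ₗ[A] Y) (hp : Function.Surjective p) (q : X →ₗ[A] Z) (h : ∀ x, p x = 0 → q x = 0) :
    ∃ k : Y →ₗ[A] Z, ∀ x, k (p x) = q x := by
  have hker : LinearMap.ker p ≤ LinearMap.ker q := fun x hx => h x hx
  refine ⟨((LinearMap.ker p).liftQ q hker) ∘ₗ (p.quotKerEquivOfSurjective hp).symm.toLinearMap,
    fun x => ?_⟩
  have : (p.quotKerEquivOfSurjective hp).symm (p x) = (LinearMap.ker p).mkQ x := by
    rw [LinearEquiv.symm_apply_eq]; rfl
  simp [this]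

/-- An injective module extends linear maps between small modules, even if the ring itself is
not small. -/
theorem Module.Injective.exists_extension_of_small {A X Y : Type*} {E : Type v} [Ring A]
    [AddCommGroup E] [Module A E] (inj : Module.Injective A E)
    [AddCommGroup X] [AddCommGroup Y] [Module A X] [Module A Y] [Small.{v} X] [Small.{v} Y]
    (f : X →ₗ[A] Y) (hf : Function.Injective f) (g : X →ₗ[A] E) :
    ∃ h : Y →ₗ[A] E, ∀ x, h (f x) = g x := by
  let eX := Shrink.linearEquiv A X
  let eY := Shrink.linearEquiv A Y
  obtain ⟨h, hh⟩ := inj.out (eY.symm.toLinearMap ∘ₗ f ∘ₗ eX.toLinearMap)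
    (eY.symm.injective.comp (hf.comp eX.injective)) (g ∘ₗ eX.toLinearMap)
  exact ⟨h ∘ₗ eY.symm.toLinearMap, fun x => by simpa using hh (eX.symm x)⟩

theorem Submodule.small_quotient_ideal_smul {R M : Type*} [CommRing R] [AddCommGroup M]
    [Module R M] (I : Ideal R) (N : Submodule R M) (hN : N.FG) [Small.{v} (R ⧸ I)]
    [Small.{v} (M ⧸ N)] : Small.{v} (M ⧸ I • N) := by
  obtain ⟨n, b, hb⟩ := Submodule.fg_iff_exists_fin_generating_family.mp hN
  let σ : M ⧸ N → M := Quotient.out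
  let τ : R ⧸ I → R := Quotient.out
  have hσ (x : M ⧸ N) : N.mkQ (σ x) = x := Quotient.out_eq x
  have hτ (x : R ⧸ I) : Ideal.Quotient.mk I (τ x) = x := Quotient.out_eq x
  refine small_of_surjective
    (f := fun x : (M ⧸ N) × (Fin n → R ⧸ I) =>
      (I • N).mkQ (σ x.1 + ∑ i, τ (x.2 i) • b i)) ?_
  intro y
  obtain ⟨m, rfl⟩ := (I • N).mkQ_surjective y
  have hm : m - σ (N.mkQ m) ∈ N := by
    rw [← Submodule.Quotient.mk_eq_zero, ← Submodule.mkQ_apply, map_sub, hσ, sub_self]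
  obtain ⟨c, hc⟩ := (Submodule.mem_span_range_iff_exists_fun R).mp (hb.ge hm)
  refine ⟨(N.mkQ m, fun i => Ideal.Quotient.mk I (c i)), ?_⟩
  rw [← sub_eq_zero, ← map_sub, ← LinearMap.mem_ker, Submodule.ker_mkQ]
  have key : σ (N.mkQ m) + ∑ i, τ (Ideal.Quotient.mk I (c i)) • b i - m =
      ∑ i, (τ (Ideal.Quotient.mk I (c i)) - c i) • b i := by
    simp only [sub_smul, Finset.sum_sub_distrib, hc]
    abel
  simp only [key]
  refine Submodule.sum_mem _ fun i _ => Submodule.smul_mem_smul ?_ ?_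
  · rw [← Ideal.Quotient.eq_zero_iff_mem, map_sub, hτ, sub_self]
  · rw [← hb]; exact Submodule.subset_span ⟨i, rfl⟩

theorem Submodule.small_quotient_ideal_pow_smul_top {R M : Type*} [CommRing R] [AddCommGroup M]
    [Module R M] [IsNoetherian R M] (I : Ideal R) [Small.{v} (R ⧸ I)] (n : ℕ) :
    Small.{v} (M ⧸ (I ^ n • ⊤ : Submodule R M)) := by
  induction n with
  | zero =>
    have : Subsingleton (M ⧸ (I ^ 0 • ⊤ : Submodule R M)) := by
      rw [Submodule.Quotient.subsingleton_iff]; simp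
    infer_instance
  | succ n ih =>
    rw [pow_succ', ← smul_eq_mul, Submodule.smul_assoc]
    exact Submodule.small_quotient_ideal_smul I _ (IsNoetherian.noetherian _)

/-- Over a ring finite over a noetherian central subring, injective modules satisfy Baer's
criterion without any smallness assumption on the ring. -/
theorem Module.Baer.of_injective_of_finite (R : Type*) {A : Type*} {E : Type v} [CommRing R]
    [Ring A] [Algebra R A] [IsNoetherianRing R] [Module.Finite R A] [AddCommGroup E] [Module A E]
    (inj : Module.Injective A E) : Module.Baer A E := by
  intro I g
  let : Module R E := Module.compHom E (algebraMap R A)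
  have : IsScalarTower R A E := ⟨fun r a x => by
    rw [Algebra.smul_def, mul_smul]; rfl⟩
  have hnoeth : IsNoetherian R A := isNoetherian_of_isNoetherianRing_of_finite R A
  let IR : Submodule R A := I.restrictScalars R
  let gR : IR →ₗ[R] E := g.restrictScalars R
  obtain ⟨n, b, hb⟩ := Submodule.fg_iff_exists_fin_generating_family.mp
    (LinearMap.range_eq_map gR ▸ (IsNoetherian.noetherian (⊤ : Submodule R IR)).map gR)
  let φ : R →ₗ[R] (Fin n → E) := LinearMap.pi fun i => LinearMap.toSpanSingleton R E (b i)
  let 𝔞 : Ideal R := LinearMap.ker φ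
  have hkill : ∀ r ∈ 𝔞, ∀ x : IR, r • gR x = 0 := by
    intro r hr x
    have hx : gR x ∈ Submodule.span R (Set.range b) := hb ▸ LinearMap.mem_range_self gR x
    generalize gR x = w at hx ⊢
    induction hx using Submodule.span_induction with
    | mem y hy =>
      obtain ⟨i, rfl⟩ := hy
      exact congrFun hr i
    | zero => simp
    | add y z _ _ hy hz => rw [smul_add, hy, hz, add_zero]
    | smul c y _ hy => rw [smul_comm, hy, smul_zero]
  have : Small.{v} (R ⧸ 𝔞) :=
    small_of_injective (φ.quotKerEquivRange.injective)
  obtain ⟨k, hk⟩ := Ideal.exists_pow_inf_eq_pow_smul 𝔞 IR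
  let J : Ideal A :=
    { (𝔞 ^ (k + 1) • ⊤ : Submodule R A) with
      smul_mem' := fun c x hx => by
        change c • x ∈ (𝔞 ^ (k + 1) • ⊤ : Submodule R A)
        replace hx : x ∈ (𝔞 ^ (k + 1) • ⊤ : Submodule R A) := hx
        induction hx using Submodule.smul_induction_on' with
        | smul r hr y _ =>
          rw [smul_comm]
          exact Submodule.smul_mem_smul hr trivial
        | add y _ z _ hy hz =>
          rw [smul_add]
          exact Submodule.add_mem _ hy hz }
  have hsmall : Small.{v} (A ⧸ (𝔞 ^ (k + 1) • ⊤ : Submodule R A)) :=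
    Submodule.small_quotient_ideal_pow_smul_top 𝔞 (k + 1)
  have : Small.{v} (A ⧸ J) := hsmall
  have hgJ : ∀ x : I, J.mkQ (x : A) = 0 → g x = 0 := by
    intro x hx
    have hxJ : (x : A) ∈ (𝔞 ^ (k + 1) • ⊤ : Submodule R A) := by
      rw [← LinearMap.mem_ker, Submodule.ker_mkQ] at hx
      exact hx
    have hx' : (x : A) ∈ 𝔞 • IR := by
      have h1 : (x : A) ∈ (𝔞 ^ (k + 1) • ⊤ ⊓ IR : Submodule R A) := ⟨hxJ, x.2⟩
      rw [hk (k + 1) (Nat.le_succ k), Nat.add_sub_cancel_left, pow_one] at h1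
      exact Submodule.smul_mono le_rfl inf_le_right h1
    suffices H : ∀ (y : A), y ∈ 𝔞 • IR → ∀ hy : y ∈ IR, gR ⟨y, hy⟩ = 0 from H x hx' x.2
    intro y hy
    induction hy using Submodule.smul_induction_on' with
    | smul r hr z hz =>
      intro _
      have := hkill r hr ⟨z, hz⟩
      rwa [← map_smul] at this
    | add y hy z hz h1 h2 =>
      intro _
      have hy' : y ∈ IR := Submodule.smul_le_right hy
      have hz' : z ∈ IR := Submodule.smul_le_right hz
      have := map_add gR ⟨y, hy'⟩ ⟨z, hz'⟩
      rw [h1 hy', h2 hz', add_zero] at this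
      exact this
  let h : I →ₗ[A] A ⧸ J := J.mkQ ∘ₗ I.subtype
  obtain ⟨g₁, hg₁⟩ := LinearMap.exists_factor_of_surjective h.rangeRestrict
    h.surjective_rangeRestrict g fun x hx => hgJ x (congrArg Subtype.val hx)
  obtain ⟨g₂, hg₂⟩ := inj.exists_extension_of_small (LinearMap.range h).subtype
    (Submodule.injective_subtype _) g₁
  refine ⟨g₂ ∘ₗ J.mkQ, fun x hx => ?_⟩
  rw [← hg₁ ⟨x, hx⟩, ← hg₂]
  rfl

end Smallness

section CentralLocalization

variable {A : Type*} [Ring A] {S : Submonoid A}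

theorem Submonoid.exists_common_of_forall_exists (hS : ∀ s ∈ S, ∀ a : A, s * a = a * s)
    {ι : Type*} [Finite ι] (P : ι → A → Prop)
    (hP : ∀ i, ∀ s ∈ S, ∀ t ∈ S, P i s → P i (t * s)) (h : ∀ i, ∃ s ∈ S, P i s) :
    ∃ s ∈ S, ∀ i, P i s := by
  classical
  have := Fintype.ofFinite ι
  suffices H : ∀ T : Finset ι, ∃ s ∈ S, ∀ i ∈ T, P i s by
    obtain ⟨s, hs, h⟩ := H Finset.univ
    exact ⟨s, hs, fun i => h i (Finset.mem_univ i)⟩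
  intro T
  induction T using Finset.induction_on with
  | empty => exact ⟨1, S.one_mem, by simp⟩
  | insert i T _ ih =>
    obtain ⟨s, hs, h1⟩ := ih
    obtain ⟨t, ht, h2⟩ := h i
    refine ⟨t * s, S.mul_mem ht hs, fun j hj => ?_⟩
    rcases Finset.mem_insert.mp hj with rfl | hj
    · rw [hS t ht]
      exact hP j t ht s hs h2
    · exact hP j s hs t ht (h1 j hj)

theorem Submodule.exists_smul_eq_zero_of_fg (hS : ∀ s ∈ S, ∀ a : A, s * a = a * s) {E : Type*}
    [AddCommGroup E] [Module A E] {K : Submodule A E} (hK : K.FG)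
    (h : ∀ x ∈ K, ∃ s ∈ S, s • x = 0) : ∃ s ∈ S, ∀ x ∈ K, s • x = 0 := by
  obtain ⟨n, b, rfl⟩ := Submodule.fg_iff_exists_fin_generating_family.mp hK
  obtain ⟨s, hs, hb⟩ := Submonoid.exists_common_of_forall_exists hS
    (fun i s => s • b i = 0) (fun i s _ t _ h => by rw [mul_smul, h, smul_zero])
    (fun i => h (b i) (Submodule.subset_span ⟨i, rfl⟩))
  refine ⟨s, hs, fun x hx => ?_⟩
  induction hx using Submodule.span_induction with
  | mem y hy => obtain ⟨i, rfl⟩ := hy; exact hb i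
  | zero => simp
  | add y z _ _ hy hz => rw [smul_add, hy, hz, add_zero]
  | smul c y _ hy => rw [← mul_smul, hS s hs, mul_smul, hy, smul_zero]

/-- Multiplication by a central element, as a linear map. -/
def LinearMap.centralSMul (M : Type*) [AddCommGroup M] [Module A M] (s : A)
    (hs : ∀ a : A, s * a = a * s) : M →ₗ[A] M where
  toFun x := s • x
  map_add' := smul_add s
  map_smul' a x := by rw [RingHom.id_apply, ← mul_smul, hs, mul_smul]

namespace OreLocalization

variable [OreSet S] {E : Type*} [AddCommGroup E] [Module A E]

/-- The canonical linear map from a module to its Ore localization. -/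
def numeratorLinearMap (S : Submonoid A) [OreSet S] (E : Type*) [AddCommGroup E] [Module A E] :
    E →ₗ[A] OreLocalization S E where
  toFun e := e /ₒ (1 : S)
  map_add' _ _ := add_oreDiv.symm
  map_smul' a e := (smul_oreDiv_one a e).symm

theorem numeratorLinearMap_apply (e : E) : numeratorLinearMap S E e = e /ₒ (1 : S) := rfl

theorem numeratorLinearMap_eq_zero_iff (e : E) :
    numeratorLinearMap S E e = 0 ↔ ∃ s ∈ S, s • e = 0 := by
  rw [numeratorLinearMap_apply, ← zero_oreDiv (1 : S), oreDiv_eq_iff]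
  constructor
  · rintro ⟨u, v, h1, h2⟩
    refine ⟨u, u.2, ?_⟩
    have : (u : A) = v := by simpa using h2
    rw [this, ← h1, smul_zero]
  · rintro ⟨s, hs, h⟩
    exact ⟨⟨s, hs⟩, s, by simp [h], by simp⟩

theorem smul_oreDiv_self (e : E) (s : S) :
    (s : A) • (e /ₒ s) = numeratorLinearMap S E e := by
  rw [← oreDiv_one_smul, OreLocalization.smul_cancel, numeratorLinearMap_apply]

/-- A linear map from a finite module to a localization at a central set lifts, up to a
denominator, to a map into the module itself. -/
theorem exists_lift_of_central [IsNoetherianRing A] (hS : ∀ s ∈ S, ∀ a : A, s * a = a * s)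
    {P : Type*} [AddCommGroup P] [Module A P] [Module.Finite A P]
    (g : P →ₗ[A] OreLocalization S E) :
    ∃ s ∈ S, ∃ f : P →ₗ[A] E, ∀ x, numeratorLinearMap S E (f x) = s • g x := by
  obtain ⟨n, p, hp⟩ := Module.Finite.exists_fin' A P
  obtain ⟨s, hs, hb⟩ := Submonoid.exists_common_of_forall_exists hS
    (fun i s => ∃ e, numeratorLinearMap S E e = s • g (p (Pi.basisFun A (Fin n) i)))
    (fun i s _ t _ ⟨e, he⟩ => ⟨t • e, by rw [map_smul, he, mul_smul]⟩)
    (fun i => by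
      induction g (p (Pi.basisFun A (Fin n) i)) using OreLocalization.ind with
      | _ e s => exact ⟨s, s.2, e, (smul_oreDiv_self e s).symm⟩)
  choose e he using hb
  let q₀ : (Fin n → A) →ₗ[A] E := (Pi.basisFun A (Fin n)).constr ℕ e
  have hq₀ : numeratorLinearMap S E ∘ₗ q₀ =
      LinearMap.centralSMul (OreLocalization S E) s (hS s hs) ∘ₗ g ∘ₗ p := by
    refine (Pi.basisFun A (Fin n)).ext fun i => ?_
    rw [LinearMap.comp_apply, Module.Basis.constr_basis, he]
    rfl
  obtain ⟨t, ht, hK⟩ := Submodule.exists_smul_eq_zero_of_fg hS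
    (K := (LinearMap.ker p).map q₀) ((IsNoetherian.noetherian _).map _) (by
      rintro _ ⟨v, hv, rfl⟩
      rw [← numeratorLinearMap_eq_zero_iff]
      refine (LinearMap.congr_fun hq₀ v).trans ?_
      change s • g (p v) = 0
      rw [LinearMap.mem_ker.mp hv, map_zero, smul_zero])
  obtain ⟨f, hf⟩ := LinearMap.exists_factor_of_surjective p hp
    (LinearMap.centralSMul E t (hS t ht) ∘ₗ q₀) fun v hv => hK _ ⟨v, hv, rfl⟩
  refine ⟨t * s, S.mul_mem ht hs, f, fun x => ?_⟩
  obtain ⟨v, rfl⟩ := hp x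
  rw [hf, mul_smul]
  change numeratorLinearMap S E (t • q₀ v) = _
  rw [map_smul]
  exact congrArg (t • ·) (LinearMap.congr_fun hq₀ v)

theorem baer_of_central [IsNoetherianRing A] (hS : ∀ s ∈ S, ∀ a : A, s * a = a * s)
    (hE : Module.Baer A E) : Module.Baer (OreLocalization S A) (OreLocalization S E) := by
  intro J g
  let ν := numeratorLinearMap S A
  let I : Ideal A := (J.restrictScalars A).comap ν
  let gI : I →ₗ[A] OreLocalization S E :=
    g.restrictScalars A ∘ₗ ν.restrict (p := I) (q := J.restrictScalars A) fun _ h => h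
  obtain ⟨s, hs, f, hf⟩ := exists_lift_of_central hS gI
  obtain ⟨f', hf'⟩ := hE I f
  refine ⟨LinearMap.toSpanSingleton _ _ (f' 1 /ₒ (⟨s, hs⟩ : S)), fun x hx => ?_⟩
  induction x using OreLocalization.ind with
  | _ a u =>
  have hau : (u : A) • (a /ₒ u) = ν a := smul_oreDiv_self a u
  have ha : a ∈ I := by
    change ν a ∈ J
    rw [← hau]
    exact (J.restrictScalars A).smul_mem _ hx
  have hcancel : ∀ (w : S) (y z : OreLocalization S E), (w : A) • y = (w : A) • z → y = z := by
    intro w y z h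
    rw [← oreDiv_one_smul, ← oreDiv_one_smul] at h
    have := congrArg (((1 : A) /ₒ w) • ·) h
    simpa only [smul_smul, smul_div_one, OreLocalization.one_div_mul, one_mul,
      OreLocalization.div_eq_one, one_smul] using this
  apply hcancel u
  have h1 : (u : A) • g ⟨a /ₒ u, hx⟩ = gI ⟨a, ha⟩ := by
    have := (g.restrictScalars A).map_smul (u : A) ⟨a /ₒ u, hx⟩
    refine this.symm.trans (congrArg g (Subtype.ext hau))
  rw [h1, LinearMap.toSpanSingleton_apply, ← smul_assoc, hau]
  apply hcancel ⟨s, hs⟩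
  change s • ((a /ₒ (1 : S)) • _) = s • _
  rw [← hf, oreDiv_one_smul, ← mul_smul, hS s hs, mul_smul]
  refine (congrArg (a • ·) (smul_oreDiv_self (f' 1) (⟨s, hs⟩ : S))).trans ?_
  rw [← hf' a ha, ← map_smul, ← map_smul, smul_eq_mul, mul_one]

theorem essential_of_central [IsNoetherianRing A] (hS : ∀ s ∈ S, ∀ a : A, s * a = a * s)
    (M : Submodule A E) (hess : ∀ N : Submodule A E, N ≠ ⊥ → N ⊓ M ≠ ⊥)
    (N : Submodule (OreLocalization S A) (OreLocalization S E)) (hN : N ≠ ⊥) :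
    N ⊓ Submodule.span (OreLocalization S A)
      {x : OreLocalization S E | ∃ e ∈ M, x = e /ₒ (1 : S)} ≠ ⊥ := by
  obtain ⟨y, hyN, hy⟩ := N.exists_mem_ne_zero_of_ne_bot hN
  let ν := numeratorLinearMap S E
  obtain ⟨x, hxN, hx⟩ : ∃ x, ν x ∈ N ∧ ν x ≠ 0 := by
    induction y using OreLocalization.ind with
    | _ e s =>
    have hes : (s : A) • (e /ₒ s) = ν e := smul_oreDiv_self e s
    refine ⟨e, hes ▸ (N.restrictScalars A).smul_mem _ hyN, fun h => hy ?_⟩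
    obtain ⟨t, ht, hte⟩ := (numeratorLinearMap_eq_zero_iff e).mp h
    rw [OreLocalization.expand' e s ⟨t, ht⟩, Submonoid.mk_smul, hte, zero_oreDiv]
  obtain ⟨s, hs, hkill⟩ := Submodule.exists_smul_eq_zero_of_fg hS
    (K := Submodule.span A {x} ⊓ LinearMap.ker ν)
    (by
      have : IsNoetherian A (Submodule.span A {x}) :=
        isNoetherian_of_fg_of_noetherian _ (Submodule.fg_span_singleton x)
      exact (isNoetherian_submodule.mp this) _ inf_le_left)
    (fun z hz => (numeratorLinearMap_eq_zero_iff z).mp hz.2)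
  have hsx : s • x ≠ 0 := fun h => hx ((numeratorLinearMap_eq_zero_iff x).mpr ⟨s, hs, h⟩)
  obtain ⟨z, ⟨hz, hzM⟩, hz0⟩ := Submodule.exists_mem_ne_zero_of_ne_bot
    (hess (Submodule.span A {s • x}) (by simpa using hsx))
  obtain ⟨a, rfl⟩ := Submodule.mem_span_singleton.mp hz
  refine (Submodule.ne_bot_iff _).mpr ⟨ν (a • s • x), ⟨?_, ?_⟩, fun h => hz0 ?_⟩
  · rw [map_smul, map_smul]
    exact (N.restrictScalars A).smul_mem _ ((N.restrictScalars A).smul_mem _ hxN)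
  · exact Submodule.subset_span ⟨_, hzM, rfl⟩
  · have hcomm : a • s • x = s • a • x := by rw [← mul_smul, ← hS s hs, mul_smul]
    rw [hcomm]
    refine hkill _ ⟨Submodule.smul_mem _ _ (Submodule.mem_span_singleton_self x), ?_⟩
    obtain ⟨t, ht, hts⟩ := (numeratorLinearMap_eq_zero_iff _).mp h
    refine (numeratorLinearMap_eq_zero_iff _).mpr ⟨t * s, S.mul_mem ht hs, ?_⟩
    rw [mul_smul, ← hcomm, hts]

end OreLocalization

end CentralLocalization

/-- Let `A` be a ring which is finite over a noetherian central
subring `R`, and let `S` be a multiplicative subset of `R` (hence central in `A`, so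
the Ore localizations `A[S⁻¹]` and `M[S⁻¹]` exist).  Let `M ⊆ E` with `E` an injective
left `A`-module containing `M` as an essential submodule (so `E` is an injective hull
of `M`).  Then `E[S⁻¹]` is an injective hull of `M[S⁻¹]` as a left `A[S⁻¹]`-module:
`E[S⁻¹]` is injective over `A[S⁻¹]` and the canonical image of `M[S⁻¹]` (the
`A[S⁻¹]`-submodule generated by the image of `M`) is essential in `E[S⁻¹]`. -/
theorem injectiveHull_oreLocalization {A : Type*} [Ring A]
    (R : Subring A) (hcent : ∀ r ∈ R, ∀ a : A, r * a = a * r)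
    [IsNoetherianRing R] [Module.Finite R A]
    (S : Submonoid A) (hS : (S : Set A) ⊆ (R : Set A))
    (E : Type*) [AddCommGroup E] [Module A E] (M : Submodule A E)
    (hinj : Module.Injective A E)
    (hess : ∀ N : Submodule A E, N ≠ ⊥ → N ⊓ M ≠ ⊥) :
    letI : OreSet S := centralOreSet S (fun s hs a => hcent s (hS hs) a)
    Module.Injective (OreLocalization S A) (OreLocalization S E) ∧
      ∀ N : Submodule (OreLocalization S A) (OreLocalization S E), N ≠ ⊥ →
        N ⊓ Submodule.span (OreLocalization S A)
            {x : OreLocalization S E | ∃ e ∈ M, x = e /ₒ (1 : S)} ≠ ⊥ := by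
  have hSc : ∀ s ∈ S, ∀ a : A, s * a = a * s := fun s hs a => hcent s (hS hs) a
  let : OreSet S := centralOreSet S hSc
  let : CommRing R :=
    { (inferInstance : Ring R) with mul_comm := fun x y => Subtype.ext (hcent x x.2 y) }
  let : Algebra R A := Algebra.ofModule (fun r x y => mul_assoc (r : A) x y)
    (fun r x y => by
      change x * ((r : A) * y) = (r : A) * (x * y)
      rw [← mul_assoc, ← hcent r r.2, mul_assoc])
  have : IsNoetherianRing A :=
    isNoetherian_of_tower R (isNoetherian_of_isNoetherianRing_of_finite R A)
  exact ⟨(OreLocalization.baer_of_central hSc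
    (Module.Baer.of_injective_of_finite R hinj)).injective,
    OreLocalization.essential_of_central hSc M hess⟩
end
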